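/- Let Σ be a finite alphabet and let L₁ and L₂ be finite languages over Σ accepted by partial DFAs with m states and n states respectively, where m, n ≥ 2. Then L₁ ∩ L₂ is accepted by a partial DFA with at most m·n − 2m − 2n + 6 states; in particular isc(L₁ ∩ L₂) ≤ m·n − 2m − 2n + 6. -/

import Mathlib

open scoped Computability
open scoped Classical

/-- A partial DFA over alphabet `α` with state set `Fin n`. -/
structure PDFA (α : Type) (n : ℕ) where
  step : Fin n → α → Option (Fin n)
  start : Fin n
  accept : Finset (Fin n)

namespace PDFA

variable {α : Type} {n : ℕ}

/-- Run the partial DFA from a state along a word; `none` if a transition is undefined. -/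
def evalFrom (M : PDFA α n) : Fin n → List α → Option (Fin n)
  | q, [] => some q
  | q, a :: w => (M.step q a).bind fun q' => M.evalFrom q' w

/-- The language accepted by a partial DFA. -/
def lang (M : PDFA α n) : Language α :=
  {w | ∃ q ∈ M.accept, M.evalFrom M.start w = some q}

/-- The number of defined transitions. -/
noncomputable def transCount [Fintype α] (M : PDFA α n) : ℕ :=
  (Finset.univ.filter fun p : Fin n × α => (M.step p.1 p.2).isSome).card

/-- The number of defined `τ`-transitions. -/
noncomputable def transCountOn (M : PDFA α n) (τ : α) : ℕ :=
  (Finset.univ.filter fun q : Fin n => (M.step q τ).isSome).card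

/-- `s_τ`: 1 if a `τ`-transition is defined at the initial state, else 0. -/
def sOn (M : PDFA α n) (τ : α) : ℕ := if (M.step M.start τ).isSome then 1 else 0

/-- `s`: total over the alphabet of `s_τ`. -/
noncomputable def sTot [Fintype α] (M : PDFA α n) : ℕ := ∑ τ : α, M.sOn τ

/-- `s̄_τ = 1 - s_τ`. -/
def sbarOn (M : PDFA α n) (τ : α) : ℕ := 1 - M.sOn τ

/-- `a_τ`: the number of defined `τ`-transitions entering a final state. -/
noncomputable def aOn (M : PDFA α n) (τ : α) : ℕ :=
  (Finset.univ.filter fun p : Fin n => ∃ q ∈ M.accept, M.step p τ = some q).card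

/-- `e_τ`: the number of final states at which a `τ`-transition is defined. -/
noncomputable def eOn (M : PDFA α n) (τ : α) : ℕ :=
  (M.accept.filter fun q => (M.step q τ).isSome).card

/-- `ē_τ`: the number of final states at which no `τ`-transition is defined. -/
noncomputable def ebarOn (M : PDFA α n) (τ : α) : ℕ :=
  (M.accept.filter fun q => M.step q τ = none).card

/-- `t̄_τ`: the number of states at which no `τ`-transition is defined. -/
noncomputable def tbarOn (M : PDFA α n) (τ : α) : ℕ :=
  (Finset.univ.filter fun q : Fin n => M.step q τ = none).card

/-- `f(A)`: the number of final states. -/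
def fTot (M : PDFA α n) : ℕ := M.accept.card

/-- `f(A, i)`: the number of final states numbered strictly less than `i`. -/
noncomputable def fBelow (M : PDFA α n) (i : ℕ) : ℕ :=
  (M.accept.filter fun q => (q : ℕ) < i).card

/-- `t̄_τ(L, i)`: 1 if no `τ`-transition is defined at state `i`, else 0. -/
noncomputable def tbarAt (M : PDFA α n) (τ : α) (i : ℕ) : ℕ :=
  if h : i < n then (if M.step ⟨i, h⟩ τ = none then 1 else 0) else 0

/-- The states (numbered by `Fin n`) are topologically ordered: the initial state is `0`
and every defined transition goes from a smaller-numbered to a larger-numbered state. -/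
def Ordered (M : PDFA α n) : Prop :=
  (M.start : ℕ) = 0 ∧ ∀ q a q', M.step q a = some q' → q < q'

end PDFA

/-- The incomplete state complexity: the minimal number of states of a partial DFA
accepting `L`. -/
noncomputable def isc {α : Type} (L : Language α) : ℕ :=
  sInf {m | ∃ M : PDFA α m, M.lang = L}

/-- The incomplete transition complexity: the minimal number of defined transitions
over all partial DFAs accepting `L`. -/
noncomputable def itc {α : Type} [Fintype α] (L : Language α) : ℕ :=
  sInf {t | ∃ m, ∃ M : PDFA α m, M.lang = L ∧ M.transCount = t}

/-- The minimal number of defined `τ`-transitions over all partial DFAs accepting `L`. -/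
noncomputable def itcOn {α : Type} (L : Language α) (τ : α) : ℕ :=
  sInf {t | ∃ m, ∃ M : PDFA α m, M.lang = L ∧ M.transCountOn τ = t}

namespace PDFA

variable {α : Type} {n : ℕ}

theorem evalFrom_append (M : PDFA α n) (q : Fin n) (u v : List α) :
    M.evalFrom q (u ++ v) = (M.evalFrom q u).bind fun p => M.evalFrom p v := by
  induction u generalizing q with
  | nil => rfl
  | cons a u ih =>
    simp only [List.cons_append, evalFrom, Option.bind_assoc]
    exact congrArg _ (funext ih)

/-- The language accepted by a partial DFA when started in the state `q`. -/
def langFrom (M : PDFA α n) (q : Fin n) : Language α :=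
  {w | ∃ r ∈ M.accept, M.evalFrom q w = some r}

theorem leftQuotient_lang_of_eval_eq_some (M : PDFA α n) {w : List α} {p : Fin n}
    (h : M.evalFrom M.start w = some p) : M.lang.leftQuotient w = M.langFrom p := by
  ext x
  change (∃ r ∈ M.accept, M.evalFrom M.start (w ++ x) = some r) ↔
    ∃ r ∈ M.accept, M.evalFrom p x = some r
  rw [evalFrom_append, h]
  rfl

theorem leftQuotient_lang_of_eval_eq_none (M : PDFA α n) {w : List α}
    (h : M.evalFrom M.start w = none) : M.lang.leftQuotient w = ⊥ := by
  ext x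
  change (∃ r ∈ M.accept, M.evalFrom M.start (w ++ x) = some r) ↔ False
  simp [evalFrom_append, h]

/-- For a finite language, every quotient by a nonempty word that is not contained in `{ε}` is
the language of one of at most `n - 2` states: the initial state and the state reached by a
longest word are not needed. -/
theorem exists_card_le_leftQuotient_eq_langFrom (M : PDFA α n)
    (hfin : Set.Finite {w : List α | w ∈ M.lang}) :
    ∃ A : Finset (Fin n), A.card ≤ n - 2 ∧ ∀ w : List α, w ≠ [] →
      M.lang.leftQuotient w ≤ 1 ∨ ∃ p ∈ A, M.lang.leftQuotient w = M.langFrom p := by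
  rcases Set.eq_empty_or_nonempty {w : List α | w ∈ M.lang} with hempty | hne
  · refine ⟨∅, by simp, fun w _ => Or.inl fun x hx => ?_⟩
    exact (Set.eq_empty_iff_forall_notMem.1 hempty (w ++ x) hx).elim
  obtain ⟨v, hv, hmax⟩ := Set.exists_max_image _ List.length hfin hne
  obtain ⟨f, hf, hvf⟩ := hv
  have hstart : ∀ w, w ≠ [] → M.evalFrom M.start w ≠ some M.start := fun w hw hws => by
    have hmem : w ++ v ∈ M.lang := ⟨f, hf, by rw [evalFrom_append, hws]; exact hvf⟩
    have hlen := hmax (w ++ v) hmem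
    have := List.length_pos_iff.2 hw
    simp only [List.length_append] at hlen
    omega
  by_cases hv0 : v = []
  · refine ⟨∅, by simp, fun w hw => Or.inl fun x hx => ?_⟩
    have hlen := hmax (w ++ x) hx
    simp [hv0, hw] at hlen
  have hfs : M.start ≠ f := fun h => hstart v hv0 (h ▸ hvf)
  refine ⟨{M.start, f}ᶜ, ?_, fun w hw => ?_⟩
  · rw [Finset.card_compl, Finset.card_pair hfs, Fintype.card_fin]
  cases hwp : M.evalFrom M.start w with
  | none => exact Or.inl (by rw [M.leftQuotient_lang_of_eval_eq_none hwp]; exact bot_le)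
  | some p =>
    rw [M.leftQuotient_lang_of_eval_eq_some hwp]
    by_cases hpf : p = f
    · refine Or.inl fun x hx => ?_
      subst hpf
      rw [← M.leftQuotient_lang_of_eval_eq_some hvf] at hx
      have hlen := hmax (v ++ x) hx
      exact (Language.mem_one x).2 (by simpa using hlen)
    · have hps : p ≠ M.start := fun h => hstart w hw (h ▸ hwp)
      exact Or.inr ⟨p, by simp [hpf, hps], rfl⟩

/-- The partial DFA whose states are the languages in a family enumerated by `e`, with
transitions given by left quotients. -/
noncomputable def ofLanguages {T : Set (Language α)} (e : T ≃ Fin n) (L : T) : PDFA α n where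
  step i a :=
    if h : (e.symm i).1.leftQuotient [a] ∈ T then some (e ⟨_, h⟩) else none
  start := e L
  accept := Finset.univ.filter fun i => [] ∈ (e.symm i).1

theorem lang_ofLanguages {T : Set (Language α)} (e : T ≃ Fin n) (L : T)
    (hT : ∀ K ∈ T, ∀ a, K.leftQuotient [a] ∈ T ∨ K.leftQuotient [a] = ⊥) :
    (ofLanguages e L).lang = L := by
  have key : ∀ (w : List α) (K : T),
      (∃ r ∈ (ofLanguages e L).accept, (ofLanguages e L).evalFrom (e K) w = some r) ↔ w ∈ K.1 := by
    intro w
    induction w with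
    | nil => intro K; simp [evalFrom, ofLanguages]
    | cons a w ih =>
      intro K
      by_cases h : K.1.leftQuotient [a] ∈ T
      · have hstep : (ofLanguages e L).step (e K) a = some (e ⟨_, h⟩) := by
          simp [ofLanguages, h]
        simp only [evalFrom, hstep, Option.bind_some]
        exact ih ⟨_, h⟩
      · have hstep : (ofLanguages e L).step (e K) a = none := by
          simp [ofLanguages, h]
        have hbot := (hT K.1 K.2 a).resolve_left h
        simp only [evalFrom, hstep, Option.bind_none, reduceCtorEq, and_false, exists_false,
          false_iff]
        intro hw
        have hmem : w ∈ K.1.leftQuotient [a] := hw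
        rw [hbot] at hmem
        exact hmem
  ext w
  exact key w L

/-- A language whose nonempty left quotients, together with itself, lie in a finite set `U` is
accepted by a partial DFA with at most `U.card` states. -/
theorem exists_lang_eq_of_leftQuotient_mem {L : Language α} {U : Finset (Language α)}
    (hL : L ∈ U) (hU : ∀ w, L.leftQuotient w ∈ U ∨ L.leftQuotient w = ⊥) :
    ∃ k ≤ U.card, ∃ C : PDFA α k, C.lang = L := by
  set T : Set (Language α) := {K | K ∈ U ∧ ∃ w, K = L.leftQuotient w}
  have hTU : T ⊆ U := fun K hK => hK.1
  have : Finite T := U.finite_toSet.subset hTU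
  refine ⟨Nat.card T, ?_, ofLanguages (Finite.equivFin T) ⟨L, hL, [], rfl⟩,
    lang_ofLanguages _ _ ?_⟩
  · exact (Set.ncard_le_ncard hTU U.finite_toSet).trans_eq (Set.ncard_coe_finset U)
  · rintro K ⟨-, w, rfl⟩ a
    rw [← Language.leftQuotient_append]
    exact (hU (w ++ [a])).imp_left fun h => ⟨h, _, rfl⟩

end PDFA

/-- If finite languages `L₁`, `L₂` over a finite alphabet are accepted by
partial DFAs with `m` and `n` states respectively (`m, n ≥ 2`), then `L₁ ∩ L₂` is accepted
by a partial DFA with at most `m·n − 2m − 2n + 6` states. -/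
theorem inter_isc_upper {α : Type} [Fintype α] {m n : ℕ} (hm : 2 ≤ m) (hn : 2 ≤ n)
    (L₁ L₂ : Language α)
    (hf₁ : Set.Finite {w : List α | w ∈ L₁}) (hf₂ : Set.Finite {w : List α | w ∈ L₂})
    (M₁ : PDFA α m) (hM₁ : M₁.lang = L₁) (M₂ : PDFA α n) (hM₂ : M₂.lang = L₂) :
    (∃ k : ℕ, (k : ℤ) ≤ (m : ℤ) * n - 2 * m - 2 * n + 6 ∧ ∃ C : PDFA α k, C.lang = L₁ ⊓ L₂) ∧
      (isc (L₁ ⊓ L₂) : ℤ) ≤ (m : ℤ) * n - 2 * m - 2 * n + 6 := by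
  suffices h : ∃ k : ℕ, (k : ℤ) ≤ (m : ℤ) * n - 2 * m - 2 * n + 6 ∧
      ∃ C : PDFA α k, C.lang = L₁ ⊓ L₂ by
    refine ⟨h, ?_⟩
    obtain ⟨k, hk, C, hC⟩ := h
    have hisc : isc (L₁ ⊓ L₂) ≤ k := Nat.sInf_le ⟨C, hC⟩
    exact (Int.ofNat_le.2 hisc).trans hk
  subst hM₁ hM₂
  obtain ⟨A, hAcard, hA⟩ := M₁.exists_card_le_leftQuotient_eq_langFrom hf₁
  obtain ⟨B, hBcard, hB⟩ := M₂.exists_card_le_leftQuotient_eq_langFrom hf₂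
  set L := M₁.lang ⊓ M₂.lang
  set P := Finset.image₂ (fun p q => M₁.langFrom p ⊓ M₂.langFrom q) A B
  have eq_one_or_bot : ∀ K : Language α, K ≤ 1 → K = 1 ∨ K = ⊥ := fun K hK =>
    (Set.subset_singleton_iff_eq.1 hK).symm
  obtain ⟨k, hk, C, hC⟩ := PDFA.exists_lang_eq_of_leftQuotient_mem (L := L)
      (U := insert L (insert 1 P)) (by simp) fun w => by
    by_cases hw : w = []
    · subst hw
      exact Or.inl (Finset.mem_insert_self _ _)
    have hLw : L.leftQuotient w = M₁.lang.leftQuotient w ⊓ M₂.lang.leftQuotient w := rfl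
    have of_le_one : L.leftQuotient w ≤ 1 →
        L.leftQuotient w ∈ insert L (insert 1 P) ∨ L.leftQuotient w = ⊥ := fun h =>
      (eq_one_or_bot _ h).imp_left fun h => by simp [h]
    rcases hA w hw with h₁ | ⟨p, hp, h₁⟩
    · exact of_le_one (hLw ▸ inf_le_left.trans h₁)
    rcases hB w hw with h₂ | ⟨q, hq, h₂⟩
    · exact of_le_one (hLw ▸ inf_le_right.trans h₂)
    rw [hLw, h₁, h₂]
    exact Or.inl (Finset.mem_insert_of_mem (Finset.mem_insert_of_mem
      (Finset.mem_image₂_of_mem hp hq)))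
  refine ⟨k, ?_, C, hC⟩
  have hcard : k ≤ (m - 2) * (n - 2) + 2 := calc
    k ≤ P.card + 1 + 1 := hk.trans ((Finset.card_insert_le _ _).trans
      (Nat.succ_le_succ (Finset.card_insert_le _ _)))
    _ ≤ A.card * B.card + 2 := Nat.add_le_add_right (Finset.card_image₂_le _ _ _) 2
    _ ≤ (m - 2) * (n - 2) + 2 := Nat.add_le_add_right (Nat.mul_le_mul hAcard hBcard) 2
  zify [hm, hn] at hcard
  linarith
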